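/- Let F := χ_{[0,∞)^n} : ℝ^n → ℝ be the characteristic function of [0,∞)^n and let p ∈ [1,∞). Then for every t, τ ∈ ℝ^n and every real number l > |τ|, one has ∫_{t+l[0,1]^n} |F(τ+u) − F(u)|^p du ≤ 2^n l^{n−1} |τ|. -/

import Mathlib

open MeasureTheory Filter ENNReal Set Pointwise

noncomputable section

/-- `ℝ^n` with the Euclidean norm. -/
abbrev En (n : ℕ) : Type := EuclideanSpace ℝ (Fin n)

/-- The cube `t + l·[0,1]^n`. -/
def cube {n : ℕ} (t : En n) (l : ℝ) : Set (En n) :=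
  {u : En n | ∀ i : Fin n, u i ∈ Set.Icc (t i) (t i + l)}

variable {X Y : Type*}

/-- The Stepanov distance
`D^p_{S_{lΩ},B}(F,G) = sup_{x∈B} sup_{t∈Λ} l^{-n/p} (∫_{t+lΩ} ‖F(u;x)-G(u;x)‖^p du)^{1/p}`,
with values in `[0,∞]`.  (Note `∫_{lΩ} ‖F(t+u;x)-G(t+u;x)‖^p du = ∫_{t+lΩ} ‖F(u;x)-G(u;x)‖^p du`.) -/
def SD (n : ℕ) (p : ℝ) [NormedAddCommGroup Y] (Λ : Set (En n))
    (F G : En n → X → Y) (B : Set X) (l : ℝ) : ℝ≥0∞ :=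
  ⨆ x ∈ B, ⨆ t ∈ Λ,
    ENNReal.ofReal (l ^ (-(n : ℝ) / p)) *
      (∫⁻ u in cube t l, (‖F u x - G u x‖₊ : ℝ≥0∞) ^ p) ^ (1 / p)

/-- The Weyl `p`-distance `D^p_{W,B}(F,G) = lim_{l→∞} D^p_{S_{lΩ},B}(F,G)`
(the limit exists, hence coincides with the limit superior used here). -/
def WD (n : ℕ) (p : ℝ) [NormedAddCommGroup Y] (Λ : Set (En n))
    (F G : En n → X → Y) (B : Set X) : ℝ≥0∞ :=
  Filter.limsup (fun l => SD n p Λ F G B l) Filter.atTop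

/-- The slab of points of the cube `t + l·[0,1]^n` whose `i`-th coordinate lies between `0` and `a`
has volume at most `|a| l^{n-1}`. -/
theorem volume_cube_inter_slab_le {n : ℕ} (t : En n) {l : ℝ} (hl : 0 < l) (i : Fin n) (a : ℝ) :
    volume ({u : En n | u i ∈ Set.uIcc 0 a} ∩ cube t l) ≤
      ENNReal.ofReal (l ^ ((n : ℝ) - 1) * |a|) := by
  have hpres := EuclideanSpace.volume_preserving_symm_measurableEquiv_toLp (Fin n)
  set s : Fin n → Set ℝ :=
    Function.update (fun j => Set.Icc (t j) (t j + l)) i (Set.uIcc 0 a) with hs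
  have hsm : ∀ j, MeasurableSet (s j) := by
    intro j
    rcases eq_or_ne j i with rfl | hj
    · simp [hs, measurableSet_uIcc]
    · simp [hs, hj]
  have hsub : {u : En n | u i ∈ Set.uIcc 0 a} ∩ cube t l ⊆
      (MeasurableEquiv.toLp 2 (Fin n → ℝ)).symm ⁻¹' Set.univ.pi s := by
    rintro u ⟨hu, hc⟩ j -
    rcases eq_or_ne j i with rfl | hj
    · simpa [hs] using hu
    · simpa [hs, hj] using hc j
  refine (measure_mono hsub).trans ?_
  rw [hpres.measure_preimage (MeasurableSet.univ_pi hsm).nullMeasurableSet, volume_pi_pi]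
  have hprod : ∀ j, volume (s j) =
      Function.update (fun _ => ENNReal.ofReal l) i (ENNReal.ofReal |a|) j := by
    intro j
    rcases eq_or_ne j i with rfl | hj
    · simp [hs, Real.volume_interval]
    · simp [hs, hj]
  have hn : 1 ≤ n := i.pos
  have hpow : l ^ ((n : ℝ) - 1) = l ^ (n - 1) := by
    rw [← Real.rpow_natCast, Nat.cast_sub hn, Nat.cast_one]
  rw [Finset.prod_congr rfl fun j _ => hprod j, Finset.prod_update_of_mem (Finset.mem_univ i),
    Finset.prod_const, Finset.card_sdiff_of_subset (Finset.subset_univ _), Finset.card_univ,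
    Fintype.card_fin, Finset.card_singleton, hpow, ENNReal.ofReal_mul (by positivity),
    ENNReal.ofReal_pow hl.le, mul_comm]

/-- If the indicator of the orthant differs at `u` and `τ + u`, some coordinate of `u` lies between
`0` and the corresponding coordinate of `-τ`. -/
theorem nnnorm_indicator_orthant_sub_rpow_le {n : ℕ} {p : ℝ} (hp : 0 < p) (τ u : En n) :
    (‖({s : En n | ∀ i, 0 ≤ s i}).indicator (fun _ => (1 : ℝ)) (τ + u) -
        ({s : En n | ∀ i, 0 ≤ s i}).indicator (fun _ => (1 : ℝ)) u‖₊ : ℝ≥0∞) ^ p ≤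
      (⋃ i, {u : En n | u i ∈ Set.uIcc 0 (-τ i)}).indicator 1 u := by
  by_cases hu : u ∈ ⋃ i, {u : En n | u i ∈ Set.uIcc 0 (-τ i)}
  · rw [Set.indicator_of_mem hu]
    refine ENNReal.rpow_le_one ?_ hp.le
    simp only [Set.indicator]
    split_ifs <;> simp
  · have hiff : τ + u ∈ {s : En n | ∀ i, 0 ≤ s i} ↔ u ∈ {s : En n | ∀ i, 0 ≤ s i} := by
      simp only [Set.mem_iUnion, Set.mem_ofPred_eq, Set.mem_uIcc, not_exists, not_or, not_and,
        not_le] at hu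
      refine forall_congr' fun i => ?_
      obtain ⟨h₁, h₂⟩ := hu i
      rw [PiLp.add_apply]
      constructor <;> intro h
      · by_contra! h'
        linarith [h₂ (by linarith)]
      · linarith [h₁ h]
    simp only [Set.indicator, hiff, sub_self, nnnorm_zero, ENNReal.coe_zero,
      ENNReal.zero_rpow_of_pos hp, zero_le]

/-- with `F = χ_{[0,∞)^n} : ℝ^n → ℝ` and `p ∈ [1,∞)`, for all `t, τ ∈ ℝ^n` and
every `l > |τ|` one has `∫_{t+l[0,1]^n} |F(τ+u) − F(u)|^p du ≤ 2^n l^{n−1} |τ|`. -/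
theorem stmt19 (n : ℕ) (p : ℝ) (hp : 1 ≤ p)
    (t τ : En n) (l : ℝ) (hl : ‖τ‖ < l) :
    (∫⁻ u in cube t l,
        (‖({s : En n | ∀ i, 0 ≤ s i}).indicator (fun _ => (1 : ℝ)) (τ + u) -
          ({s : En n | ∀ i, 0 ≤ s i}).indicator (fun _ => (1 : ℝ)) u‖₊ : ℝ≥0∞) ^ p)
      ≤ ENNReal.ofReal (2 ^ n * l ^ ((n : ℝ) - 1) * ‖τ‖) := by
  have hl0 : 0 < l := (norm_nonneg τ).trans_lt hl
  have hmeas : ∀ i, MeasurableSet {u : En n | u i ∈ Set.uIcc 0 (-τ i)} := fun i =>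
    measurableSet_uIcc.preimage (by fun_prop : Measurable fun u : En n => u i)
  calc
    _ ≤ ∫⁻ u in cube t l, (⋃ i, {u : En n | u i ∈ Set.uIcc 0 (-τ i)}).indicator 1 u :=
      lintegral_mono fun u => nnnorm_indicator_orthant_sub_rpow_le (by linarith) τ u
    _ = volume.restrict (cube t l) (⋃ i, {u : En n | u i ∈ Set.uIcc 0 (-τ i)}) :=
      lintegral_indicator_one (.iUnion hmeas)
    _ ≤ ∑ i, volume.restrict (cube t l) {u : En n | u i ∈ Set.uIcc 0 (-τ i)} :=
      measure_iUnion_fintype_le _ _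
    _ ≤ ∑ _i : Fin n, ENNReal.ofReal (l ^ ((n : ℝ) - 1) * ‖τ‖) := by
      refine Finset.sum_le_sum fun i _ => ?_
      rw [Measure.restrict_apply (hmeas i)]
      refine (volume_cube_inter_slab_le t hl0 i _).trans (ENNReal.ofReal_le_ofReal ?_)
      rw [abs_neg]
      gcongr
      exact PiLp.norm_apply_le τ i
    _ = ENNReal.ofReal (n * (l ^ ((n : ℝ) - 1) * ‖τ‖)) := by
      rw [Finset.sum_const, Finset.card_univ, Fintype.card_fin, nsmul_eq_mul,
        ENNReal.ofReal_mul (Nat.cast_nonneg n), ENNReal.ofReal_natCast]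
    _ ≤ _ := by
      rw [mul_assoc]
      gcongr
      exact_mod_cast Nat.lt_two_pow_self.le
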